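/- For all n, p ∈ ℤ the Bernard–Felder operators on S satisfy: [h_n, h_p] = 2 n K δ_{n+p,0} · id, [h_n, e_p] = 2 e_{n+p}, [h_n, f_p] = −2 f_{n+p}, [e_n, f_p] = h_{n+p} + n K δ_{n+p,0} · id, [e_n, e_p] = 0, and [f_n, f_p] = 0. Hence the assignment e⊗tⁿ ↦ e_n, h⊗tⁿ ↦ h_n, f⊗tⁿ ↦ f_n, c ↦ K·id defines a representation of the affine Lie algebra ŝl(2) on S (a boson realization of the imaginary Verma module with highest weight determined by J and central charge K). -/

import Mathlib

open MvPolynomial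

/-- The ring `S = ℂ[x_m (m ∈ ℤ); y_k (k ≥ 1)]`: `inl m` indexes `x_m`, `inr k`
indexes `y_k`. -/
abbrev SSpace : Type := MvPolynomial (ℤ ⊕ {k : ℕ // 1 ≤ k}) ℂ

/-- `f_n` : multiplication by `x_n`.  (Applied to each polynomial, all the `∑ᶠ` sums
appearing below are finite, so they compute the intended operators.) -/
noncomputable def fop (n : ℤ) : SSpace → SSpace := fun q => X (Sum.inl n) * q

/-- `h_n = −2 Σ_{m∈ℤ} x_{m+n} ∂_{x_m} + [n<0] y_{−n}· + [n>0] 2nK ∂_{y_n} + δ_{n,0} J`. -/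
noncomputable def hop (K J : ℂ) (n : ℤ) : SSpace → SSpace := fun q =>
  -((2 : ℂ) • ∑ᶠ m : ℤ, X (Sum.inl (m + n)) * pderiv (Sum.inl m) q)
  + (if hn : n < 0 then X (Sum.inr ⟨(-n).toNat, by omega⟩) * q else 0)
  + (if hn : 0 < n then (2 * (n : ℂ) * K) • pderiv (Sum.inr ⟨n.toNat, by omega⟩) q else 0)
  + (if n = 0 then J else 0) • q

/-- `e_n = −Σ_{m,k∈ℤ} x_{k+m+n} ∂_{x_k} ∂_{x_m} + Σ_{k>0} y_k ∂_{x_{−k−n}}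
 + 2K Σ_{m>0} m ∂_{y_m} ∂_{x_{m−n}} + (Kn+J) ∂_{x_{−n}}`. -/
noncomputable def eop (K J : ℂ) (n : ℤ) : SSpace → SSpace := fun q =>
  -(∑ᶠ mk : ℤ × ℤ, X (Sum.inl (mk.2 + mk.1 + n)) *
      pderiv (Sum.inl mk.2) (pderiv (Sum.inl mk.1) q))
  + (∑ᶠ k : {k : ℕ // 1 ≤ k}, X (Sum.inr k) * pderiv (Sum.inl (-(k : ℤ) - n)) q)
  + (2 * K) • ∑ᶠ m : {m : ℕ // 1 ≤ m}, ((m : ℕ) : ℂ) •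
      pderiv (Sum.inr m) (pderiv (Sum.inl ((m : ℤ) - n)) q)
  + (K * (n : ℂ) + J) • pderiv (Sum.inl (-n)) q

/-- Commutator of two operators. -/
noncomputable def opComm (A B : SSpace → SSpace) : SSpace → SSpace :=
  fun q => A (B q) - B (A q)

namespace BernardFelder

attribute [local instance] LieRing.ofAssociativeRing

/-- Linear endomorphisms of the polynomial ring `SSpace`. -/
abbrev SEnd : Type := Module.End ℂ SSpace

/-- Multiplication by a variable. -/
noncomputable def mulX (j : ℤ ⊕ {k : ℕ // 1 ≤ k}) : SEnd := LinearMap.mulLeft ℂ (X j)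

/-- Partial derivative with respect to a variable, as an endomorphism. -/
noncomputable def pd (j : ℤ ⊕ {k : ℕ // 1 ≤ k}) : SEnd := (pderiv j).toLinearMap

@[simp] lemma mulX_apply (j) (q : SSpace) : mulX j q = X j * q := rfl

@[simp] lemma pd_apply (j) (q : SSpace) : pd j q = pderiv j q := rfl

lemma lie_apply_eq (A B : SEnd) (q : SSpace) : ⁅A, B⁆ q = A (B q) - B (A q) := rfl

@[simp] lemma smul_lie_eq (a : ℂ) (A B : SEnd) : ⁅a • A, B⁆ = a • ⁅A, B⁆ := by
  refine LinearMap.ext fun q => ?_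
  simp [smul_sub]

@[simp] lemma lie_smul_eq (a : ℂ) (A B : SEnd) : ⁅A, a • B⁆ = a • ⁅A, B⁆ := by
  refine LinearMap.ext fun q => ?_
  simp [smul_sub]

@[simp] lemma lie_one_eq (A : SEnd) : ⁅A, (1 : SEnd)⁆ = 0 := sub_self _

@[simp] lemma one_lie_eq (A : SEnd) : ⁅(1 : SEnd), A⁆ = 0 := sub_self _

lemma pd_mulX (i j) : ⁅pd i, mulX j⁆ = if i = j then 1 else 0 := by
  refine LinearMap.ext fun q => ?_
  rw [lie_apply_eq]
  simp only [mulX_apply, pd_apply, Derivation.leibniz, smul_eq_mul, pderiv_X, Pi.single_apply]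
  split_ifs with h₁ h₂ <;> simp_all

lemma pd_pd (i j) : ⁅pd i, pd j⁆ = 0 := by
  refine LinearMap.ext fun q => ?_
  have h : ⁅(pderiv i : Derivation ℂ SSpace SSpace), (pderiv j : Derivation ℂ SSpace SSpace)⁆ = 0 := by
    apply MvPolynomial.derivation_ext
    intro k
    simp [Derivation.commutator_apply, pderiv_X, Pi.single_apply, apply_ite]
  simpa [Derivation.commutator_apply] using congrArg (fun D : Derivation ℂ SSpace SSpace => D q) h

lemma mulX_mulX (i j) : ⁅mulX i, mulX j⁆ = 0 := by
  refine LinearMap.ext fun q => ?_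
  simp only [lie_apply_eq, mulX_apply, LinearMap.zero_apply]
  ring

lemma mul_lie_eq (A B C : SEnd) : ⁅A * B, C⁆ = A * ⁅B, C⁆ + ⁅A, C⁆ * B := by
  simp only [LieRing.of_associative_ring_bracket, mul_sub, sub_mul, mul_assoc]
  abel

/-- An endomorphism commuting with all variables and killing `1` vanishes. -/
lemma eq_zero_of_lie_mulX {A : SEnd} (h : ∀ j, ⁅A, mulX j⁆ = 0) (h1 : A 1 = 0) : A = 0 := by
  refine LinearMap.ext fun q => ?_
  induction q using MvPolynomial.induction_on with
  | C a => rw [C_eq_smul_one, map_smul, h1]; simp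
  | add p q hp hq => rw [map_add, hp, hq]; simp
  | mul_X p j hp =>
    have := congrArg (fun B : SEnd => B p) (h j)
    simp only [lie_apply_eq, mulX_apply, hp, LinearMap.zero_apply, mul_zero, sub_zero] at this
    rw [mul_comm, this]; rfl

/-- A family of endomorphisms is locally finite if only finitely many of its members act
nontrivially on any given polynomial. -/
def LocFinite {ι : Type*} (c : ι → SEnd) : Prop :=
  ∀ q, (Function.support fun i => c i q).Finite

/-- The pointwise sum of a locally finite family of endomorphisms. -/
noncomputable def lsum {ι : Type*} (c : ι → SEnd) (hc : LocFinite c) : SEnd where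
  toFun q := ∑ᶠ i, c i q
  map_add' p q := by
    simp only [map_add]
    exact finsum_add_distrib (hc p) (hc q)
  map_smul' a q := by
    simp only [map_smul, RingHom.id_apply]
    exact (smul_finsum a _).symm

lemma lsum_apply {ι : Type*} (c : ι → SEnd) (hc : LocFinite c) (q : SSpace) :
    lsum c hc q = ∑ᶠ i, c i q := rfl

lemma lsum_lie {ι : Type*} (c : ι → SEnd) (hc : LocFinite c) (A : SEnd) (q : SSpace) :
    ⁅lsum c hc, A⁆ q = ∑ᶠ i, ⁅c i, A⁆ q := by
  simp only [lie_apply_eq, lsum_apply]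
  have h₂ : (Function.support fun i => A (c i q)).Finite :=
    (hc q).subset fun i hi h => hi (by simp only at h; simp [h])
  rw [finsum_sub_distrib (hc (A q)) h₂]
  congr 1
  exact A.toAddMonoidHom.map_finsum (hc q)

lemma pderiv_support_finite (q : SSpace) :
    {j : ℤ ⊕ {k : ℕ // 1 ≤ k} | pderiv j q ≠ 0}.Finite :=
  q.vars.finite_toSet.subset fun j hj => by
    by_contra h
    exact hj (pderiv_eq_zero_of_notMem_vars h)

lemma locFinite_mul_pd {ι : Type*} (c : ι → SEnd) (g : ι → ℤ) (hg : Function.Injective g) :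
    LocFinite fun i => c i * pd (Sum.inl (g i)) := fun q =>
  ((pderiv_support_finite q).preimage
    (Set.injOn_of_injective (Sum.inl_injective.comp hg))).subset fun i hi h => hi (by
      simp only [Module.End.mul_apply, pd_apply, Function.comp] at h ⊢
      rw [h, map_zero])

/-- The derivation `Σ_m x_{m+n} ∂_{x_m}`. -/
noncomputable def shiftD (n : ℤ) : SEnd :=
  lsum (fun m : ℤ => mulX (Sum.inl (m + n)) * pd (Sum.inl m))
    (locFinite_mul_pd _ id Function.injective_id)

lemma shiftD_mulX_inl (n p : ℤ) :
    ⁅shiftD n, mulX (Sum.inl p)⁆ = mulX (Sum.inl (p + n)) := by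
  refine LinearMap.ext fun q => ?_
  rw [shiftD, lsum_lie, finsum_eq_single _ p]
  · simp [mul_lie_eq, pd_mulX, mulX_mulX]
  · intro m hm
    simp [mul_lie_eq, pd_mulX, mulX_mulX, hm]

lemma shiftD_mulX_inr (n : ℤ) (k) : ⁅shiftD n, mulX (Sum.inr k)⁆ = 0 := by
  refine LinearMap.ext fun q => ?_
  rw [shiftD, lsum_lie]
  simp [mul_lie_eq, pd_mulX, mulX_mulX]

lemma mulX_pd (i j) : ⁅mulX i, pd j⁆ = if j = i then -1 else 0 := by
  rw [← lie_skew, pd_mulX]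
  split_ifs <;> simp

lemma shiftD_pd_inl (n s : ℤ) : ⁅shiftD n, pd (Sum.inl s)⁆ = -pd (Sum.inl (s - n)) := by
  refine LinearMap.ext fun q => ?_
  rw [shiftD, lsum_lie, finsum_eq_single _ (s - n)]
  · simp [mul_lie_eq, pd_pd, mulX_pd]
  · intro m hm
    have : s ≠ m + n := fun h => hm (by omega)
    simp [mul_lie_eq, pd_pd, mulX_pd, this]

lemma shiftD_one (n : ℤ) : shiftD n 1 = 0 := by
  simp [shiftD, lsum_apply]

/-- The second order operator `Σ_{m,k} x_{k+m+n} ∂_{x_k} ∂_{x_m}`. -/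
noncomputable def quadD (n : ℤ) : SEnd :=
  lsum (fun m : ℤ => shiftD (m + n) * pd (Sum.inl m))
    (locFinite_mul_pd _ id Function.injective_id)

lemma quadD_mulX_inl (n p : ℤ) :
    ⁅quadD n, mulX (Sum.inl p)⁆ = (2 : ℂ) • shiftD (n + p) := by
  refine LinearMap.ext fun q => ?_
  have hc : LocFinite fun m : ℤ => mulX (Sum.inl (m + (n + p))) * pd (Sum.inl m) :=
    locFinite_mul_pd _ id Function.injective_id
  have hs : ∀ m : ℤ, m ≠ p →
      (shiftD (m + n) * (if (Sum.inl m : ℤ ⊕ {k : ℕ // 1 ≤ k}) = Sum.inl p then 1 else 0)) q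
        = 0 := by
    intro m hm
    simp [hm]
  have e : ∀ m : ℤ, ⁅shiftD (m + n) * pd (Sum.inl m), mulX (Sum.inl p)⁆ q =
      (shiftD (m + n) * (if (Sum.inl m : ℤ ⊕ {k : ℕ // 1 ≤ k}) = Sum.inl p then 1 else 0)) q +
        (mulX (Sum.inl (m + (n + p))) * pd (Sum.inl m)) q := by
    intro m
    rw [mul_lie_eq, pd_mulX, shiftD_mulX_inl, LinearMap.add_apply,
      show p + (m + n) = m + (n + p) by ring]
  rw [quadD, lsum_lie, finsum_congr e, finsum_add_distrib _ (hc q), finsum_eq_single _ p hs]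
  · change _ + shiftD (n + p) q = _
    rw [add_comm p n]
    simp [two_smul]
  · exact (Set.finite_singleton p).subset fun m hm => by
      by_contra h
      exact hm (hs m h)

lemma quadD_mulX_inr (n : ℤ) (k) : ⁅quadD n, mulX (Sum.inr k)⁆ = 0 := by
  refine LinearMap.ext fun q => ?_
  rw [quadD, lsum_lie]
  simp [mul_lie_eq, pd_mulX, shiftD_mulX_inr]

lemma quadD_apply (n : ℤ) (q : SSpace) :
    quadD n q = ∑ᶠ mk : ℤ × ℤ, X (Sum.inl (mk.2 + mk.1 + n)) *
      pderiv (Sum.inl mk.2) (pderiv (Sum.inl mk.1) q) := by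
  have hfin : {m : ℤ | pderiv (Sum.inl m) q ≠ 0}.Finite :=
    (pderiv_support_finite q).preimage (Set.injOn_of_injective Sum.inl_injective)
  rw [finsum_curry]
  · simp only [quadD, lsum_apply, shiftD, Module.End.mul_apply, mulX_apply, pd_apply, add_assoc]
  · refine (hfin.prod hfin).subset ?_
    rintro ⟨m, k⟩ h
    refine ⟨fun h' => h ?_, fun h' => h ?_⟩
    · simp only at h' ⊢
      simp [h']
    · have := congrArg (fun A : SEnd => A q) (pd_pd (Sum.inl k) (Sum.inl m))
      simp only [lie_apply_eq, pd_apply, LinearMap.zero_apply, sub_eq_zero] at this h' ⊢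
      rw [this, h']
      simp

/-- The operator `Σ_{k>0} y_k ∂_{x_{-k-n}}`. -/
noncomputable def creaD (n : ℤ) : SEnd :=
  lsum (fun k : {k : ℕ // 1 ≤ k} => mulX (Sum.inr k) * pd (Sum.inl (-(k : ℤ) - n)))
    (locFinite_mul_pd _ (fun k : {k : ℕ // 1 ≤ k} => -(k : ℤ) - n)
      fun a b h => Subtype.ext (by simp only at h; omega))

/-- The operator `Σ_{m>0} m ∂_{y_m} ∂_{x_{m-n}}`. -/
noncomputable def annD (n : ℤ) : SEnd :=
  lsum (fun m : {m : ℕ // 1 ≤ m} =>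
      (((m : ℕ) : ℂ) • pd (Sum.inr m)) * pd (Sum.inl ((m : ℤ) - n)))
    (locFinite_mul_pd _ (fun k : {k : ℕ // 1 ≤ k} => (k : ℤ) - n)
      fun a b h => Subtype.ext (by simp only at h; omega))

lemma creaD_mulX_inl (n p : ℤ) : ⁅creaD n, mulX (Sum.inl p)⁆ =
    if h : n + p < 0 then mulX (Sum.inr ⟨(-(n + p)).toNat, by omega⟩) else 0 := by
  refine LinearMap.ext fun q => ?_
  rw [creaD, lsum_lie]
  split_ifs with h
  · rw [finsum_eq_single _ ⟨(-(n + p)).toNat, by omega⟩]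
    · have : -((-(n + p)).toNat : ℤ) - n = p := by omega
      simp only [mul_lie_eq, pd_mulX, mulX_mulX, this]
      simp
    · rintro ⟨k, hk⟩ hne
      have : ¬ (-(k : ℤ) - n = p) := fun h' => hne (Subtype.ext (by simp only; omega))
      simp [mul_lie_eq, pd_mulX, mulX_mulX, this]
  · rw [finsum_eq_zero_of_forall_eq_zero]
    · rfl
    · rintro ⟨k, hk⟩
      have : ¬ (-(k : ℤ) - n = p) := by omega
      simp [mul_lie_eq, pd_mulX, mulX_mulX, this]

lemma creaD_mulX_inr (n : ℤ) (k) : ⁅creaD n, mulX (Sum.inr k)⁆ = 0 := by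
  refine LinearMap.ext fun q => ?_
  rw [creaD, lsum_lie]
  simp [mul_lie_eq, pd_mulX, mulX_mulX]

lemma annD_mulX_inl (n p : ℤ) : ⁅annD n, mulX (Sum.inl p)⁆ =
    if h : 0 < n + p then ((n + p : ℤ) : ℂ) • pd (Sum.inr ⟨(n + p).toNat, by omega⟩) else 0 := by
  refine LinearMap.ext fun q => ?_
  rw [annD, lsum_lie]
  split_ifs with h
  · rw [finsum_eq_single _ ⟨(n + p).toNat, by omega⟩]
    · have h₁ : ((n + p).toNat : ℤ) - n = p := by omega
      have h₂ : (((n + p).toNat : ℕ) : ℂ) = ((n + p : ℤ) : ℂ) := by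
        rw [← Int.cast_natCast, Int.toNat_of_nonneg h.le]
      simp only [mul_lie_eq, pd_mulX, smul_lie_eq, h₁, h₂]
      simp
    · rintro ⟨k, hk⟩ hne
      have : ¬ ((k : ℤ) - n = p) := fun h' => hne (Subtype.ext (by simp only; omega))
      simp [mul_lie_eq, pd_mulX, this]
  · rw [finsum_eq_zero_of_forall_eq_zero]
    · rfl
    · rintro ⟨k, hk⟩
      have : ¬ ((k : ℤ) - n = p) := by omega
      simp [mul_lie_eq, pd_mulX, this]

lemma annD_mulX_inr (n : ℤ) (k : {k : ℕ // 1 ≤ k}) :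
    ⁅annD n, mulX (Sum.inr k)⁆ = ((k : ℕ) : ℂ) • pd (Sum.inl ((k : ℤ) - n)) := by
  refine LinearMap.ext fun q => ?_
  rw [annD, lsum_lie, finsum_eq_single _ k]
  · simp [mul_lie_eq, pd_mulX]
  · intro m hm
    simp [mul_lie_eq, pd_mulX, hm]

/-- The Heisenberg part of `h_n`. -/
noncomputable def heis (K J : ℂ) (n : ℤ) : SEnd :=
  (if hn : n < 0 then mulX (Sum.inr ⟨(-n).toNat, by omega⟩) else 0)
  + (if hn : 0 < n then (2 * (n : ℂ) * K) • pd (Sum.inr ⟨n.toNat, by omega⟩) else 0)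
  + (if n = 0 then J else 0) • 1

/-- The operator `h_n` as a linear map. -/
noncomputable def hEnd (K J : ℂ) (n : ℤ) : SEnd :=
  -((2 : ℂ) • shiftD n) + heis K J n

/-- The operator `e_n` as a linear map. -/
noncomputable def eEnd (K J : ℂ) (n : ℤ) : SEnd :=
  -quadD n + creaD n + (2 * K) • annD n + (K * (n : ℂ) + J) • pd (Sum.inl (-n))

lemma hop_eq (K J : ℂ) (n : ℤ) : hop K J n = hEnd K J n := by
  funext q
  simp only [hop, hEnd, heis, shiftD, LinearMap.add_apply, LinearMap.neg_apply,
    LinearMap.smul_apply, lsum_apply, Module.End.mul_apply, mulX_apply, pd_apply,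
    Module.End.one_apply, ← add_assoc]
  congr 2
  · congr 1
    split_ifs <;> rfl
  · split_ifs <;> rfl

lemma eop_eq (K J : ℂ) (n : ℤ) : eop K J n = eEnd K J n := by
  funext q
  simp only [eop, eEnd, creaD, annD, LinearMap.add_apply, LinearMap.neg_apply,
    LinearMap.smul_apply, lsum_apply, Module.End.mul_apply, mulX_apply, pd_apply, quadD_apply]

lemma fop_eq (n : ℤ) : fop n = mulX (Sum.inl n) := rfl

lemma opComm_eq (A B : SEnd) : opComm A B = ⁅A, B⁆ := rfl

variable (K J : ℂ)

lemma heis_mulX_inl (n p : ℤ) : ⁅heis K J n, mulX (Sum.inl p)⁆ = 0 := by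
  unfold heis
  split_ifs <;> simp [pd_mulX, mulX_mulX]

lemma heis_pd_inl (n p : ℤ) : ⁅heis K J n, pd (Sum.inl p)⁆ = 0 := by
  unfold heis
  split_ifs <;> simp [pd_pd, mulX_pd]

lemma heis_mulX_inr (n : ℤ) (k : {k : ℕ // 1 ≤ k}) :
    ⁅heis K J n, mulX (Sum.inr k)⁆ = (if n = k then 2 * (n : ℂ) * K else 0) • 1 := by
  obtain ⟨k, hk⟩ := k
  unfold heis
  rcases lt_trichotomy n 0 with h | h | h
  · simp [h, h.ne, h.not_gt, mulX_mulX, show ¬ n = k by omega]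
  · simp [h]
  · have : n.toNat = k ↔ n = k := by omega
    by_cases hnk : n = k
    · subst hnk; simp [pd_mulX, h.not_gt, show 0 < k by omega, show k ≠ 0 by omega]
    · simp [h.not_gt, h, h.ne', pd_mulX, this, hnk]

lemma hEnd_mulX_inl (n p : ℤ) :
    ⁅hEnd K J n, mulX (Sum.inl p)⁆ = (-2 : ℂ) • mulX (Sum.inl (n + p)) := by
  rw [hEnd, add_lie, neg_lie, smul_lie_eq, heis_mulX_inl, shiftD_mulX_inl, add_zero, add_comm]
  module

lemma hEnd_mulX_inr (n : ℤ) (k : {k : ℕ // 1 ≤ k}) :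
    ⁅hEnd K J n, mulX (Sum.inr k)⁆ = (if n = k then 2 * (n : ℂ) * K else 0) • 1 := by
  simp only [hEnd, add_lie, heis_mulX_inr, neg_lie, smul_lie_eq, shiftD_mulX_inr, smul_zero,
    neg_zero, zero_add]

lemma hEnd_pd_inl (n s : ℤ) :
    ⁅hEnd K J n, pd (Sum.inl s)⁆ = (2 : ℂ) • pd (Sum.inl (s - n)) := by
  simp [hEnd, heis_pd_inl, shiftD_pd_inl]

lemma eEnd_mulX_inl (n p : ℤ) : ⁅eEnd K J n, mulX (Sum.inl p)⁆ =
    hEnd K J (n + p) + ((n : ℂ) * K * (if n + p = 0 then 1 else 0)) • 1 := by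
  have hz : (-n = p) ↔ n + p = 0 := by omega
  simp only [eEnd, hEnd, heis, add_lie, neg_lie, smul_lie_eq, quadD_mulX_inl, creaD_mulX_inl,
    annD_mulX_inl, pd_mulX, Sum.inl.injEq, hz]
  split_ifs <;> first | omega | module

lemma eEnd_mulX_inr (n : ℤ) (k : {k : ℕ // 1 ≤ k}) :
    ⁅eEnd K J n, mulX (Sum.inr k)⁆ = (2 * K * ((k : ℕ) : ℂ)) • pd (Sum.inl ((k : ℤ) - n)) := by
  simp [eEnd, quadD_mulX_inr, creaD_mulX_inr, annD_mulX_inr, pd_mulX, smul_smul]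

lemma eEnd_one (n : ℤ) : eEnd K J n 1 = 0 := by
  simp [eEnd, quadD, creaD, annD, lsum_apply]

lemma hEnd_one_neg (n : ℤ) (h : n < 0) :
    hEnd K J n 1 = mulX (Sum.inr ⟨(-n).toNat, by omega⟩) 1 := by
  simp [hEnd, heis, shiftD_one, h, h.ne, h.not_gt]

lemma hEnd_one_pos (n : ℤ) (h : 0 < n) : hEnd K J n 1 = 0 := by
  simp [hEnd, heis, shiftD_one, h, h.ne', h.not_gt]

lemma hEnd_one_zero : hEnd K J 0 1 = J • 1 := by
  simp [hEnd, heis, shiftD_one]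

lemma apply_mulX (A : SEnd) (j) (q : SSpace) :
    A (mulX j q) = ⁅A, mulX j⁆ q + mulX j (A q) := by
  rw [lie_apply_eq, sub_add_cancel]

lemma lie_smul_one (A : SEnd) (a : ℂ) : ⁅A, (a • 1 : SEnd)⁆ = 0 := by
  rw [lie_smul_eq, lie_one_eq, smul_zero]

lemma hEnd_hEnd (n p : ℤ) : ⁅hEnd K J n, hEnd K J p⁆ =
    (2 * (n : ℂ) * K * (if n + p = 0 then 1 else 0)) • 1 := by
  rw [← sub_eq_zero]
  apply eq_zero_of_lie_mulX
  · have h1 : ∀ (a : ℂ) (B : SEnd), ⁅(a • 1 : SEnd), B⁆ = 0 := fun a B => by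
      rw [smul_lie_eq, one_lie_eq, smul_zero]
    rintro (q | k)
    · rw [sub_lie, h1, lie_lie, hEnd_mulX_inl, hEnd_mulX_inl, lie_smul_eq, lie_smul_eq,
        hEnd_mulX_inl, hEnd_mulX_inl, add_left_comm, sub_self, sub_zero]
    · rw [sub_lie, h1, lie_lie, hEnd_mulX_inr, hEnd_mulX_inr, lie_smul_one, lie_smul_one,
        sub_zero, sub_zero]
  · rw [LinearMap.sub_apply, lie_apply_eq]
    rcases lt_trichotomy n 0 with hn | rfl | hn <;> rcases lt_trichotomy p 0 with hp | rfl | hp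
    · rw [hEnd_one_neg K J n hn, hEnd_one_neg K J p hp, apply_mulX, apply_mulX,
        hEnd_mulX_inr, hEnd_mulX_inr, hEnd_one_neg K J n hn, hEnd_one_neg K J p hp,
        if_neg (by simp only; omega), if_neg (by simp only; omega), if_neg (by omega)]
      simp only [zero_smul, LinearMap.zero_apply, zero_add, mul_zero, mulX_apply]
      ring
    · rw [hEnd_one_neg K J n hn, hEnd_one_zero, map_smul, apply_mulX, hEnd_mulX_inr,
        hEnd_one_zero, hEnd_one_neg K J n hn, if_neg (by simp only; omega), if_neg (by omega)]
      simp
    · rw [hEnd_one_neg K J n hn, hEnd_one_pos K J p hp, apply_mulX, hEnd_mulX_inr,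
        hEnd_one_pos K J p hp]
      by_cases h : n + p = 0
      · obtain rfl : p = -n := by omega
        rw [if_pos (by simp only; omega), if_pos h]
        simp
      · rw [if_neg (by simp only; omega), if_neg h]
        simp
    · rw [hEnd_one_neg K J p hp, hEnd_one_zero, map_smul, apply_mulX, hEnd_mulX_inr,
        hEnd_one_zero, hEnd_one_neg K J p hp, if_neg (by simp only; omega), if_neg (by omega)]
      simp
    · simp
    · simp [hEnd_one_pos K J p hp, hEnd_one_zero]
    · rw [hEnd_one_neg K J p hp, hEnd_one_pos K J n hn, apply_mulX, hEnd_mulX_inr,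
        hEnd_one_pos K J n hn]
      by_cases h : n + p = 0
      · rw [if_pos (by simp only; omega), if_pos h]
        simp
      · rw [if_neg (by simp only; omega), if_neg h]
        simp
    · simp [hEnd_one_pos K J n hn, hEnd_one_zero, hn.ne']
    · rw [hEnd_one_pos K J p hp, hEnd_one_pos K J n hn, if_neg (by omega)]
      simp

lemma eEnd_hEnd_one (n p : ℤ) : eEnd K J n (hEnd K J p 1) = 0 := by
  rcases lt_trichotomy p 0 with hp | rfl | hp
  · rw [hEnd_one_neg K J p hp, apply_mulX, eEnd_mulX_inr, eEnd_one]
    simp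
  · rw [hEnd_one_zero, map_smul, eEnd_one, smul_zero]
  · rw [hEnd_one_pos K J p hp, map_zero]

lemma hEnd_eEnd (n p : ℤ) : ⁅hEnd K J n, eEnd K J p⁆ = (2 : ℂ) • eEnd K J (n + p) := by
  rw [← sub_eq_zero]
  apply eq_zero_of_lie_mulX
  · rintro (q | k)
    · rw [sub_lie, lie_lie, eEnd_mulX_inl, hEnd_mulX_inl, smul_lie_eq, eEnd_mulX_inl, lie_add,
        lie_smul_one, hEnd_hEnd, lie_smul_eq, eEnd_mulX_inl, add_left_comm p n q, add_assoc n p q]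
      push_cast
      module
    · rw [sub_lie, lie_lie, eEnd_mulX_inr, hEnd_mulX_inr, smul_lie_eq, eEnd_mulX_inr, lie_smul_one,
        lie_smul_eq, hEnd_pd_inl, show (k : ℤ) - (n + p) = k - p - n by ring]
      module
  · simp [eEnd_one, eEnd_hEnd_one]

lemma eEnd_pd_symm (n p k : ℤ) :
    ⁅eEnd K J n, pd (Sum.inl (k - p))⁆ = ⁅eEnd K J p, pd (Sum.inl (k - n))⁆ := by
  have hx : ∀ n s q : ℤ, ⁅⁅eEnd K J n, pd (Sum.inl s)⁆, mulX (Sum.inl q)⁆ =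
      (2 : ℂ) • pd (Sum.inl (s - (n + q))) := by
    intro n s q
    have h0 : ⁅eEnd K J n, ⁅pd (Sum.inl s), mulX (Sum.inl q)⁆⁆ = 0 := by
      rw [pd_mulX]
      split_ifs <;> simp
    rw [lie_lie, h0, eEnd_mulX_inl, lie_add, lie_smul_one, ← lie_skew, hEnd_pd_inl]
    module
  have hy : ∀ (n s : ℤ) (j), ⁅⁅eEnd K J n, pd (Sum.inl s)⁆, mulX (Sum.inr j)⁆ = 0 := by
    intro n s j
    rw [lie_lie, eEnd_mulX_inr, lie_smul_eq, pd_pd, pd_mulX]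
    simp
  rw [← sub_eq_zero]
  apply eq_zero_of_lie_mulX
  · rintro (q | j)
    · rw [sub_lie, hx, hx, show k - p - (n + q) = k - n - (p + q) by ring, sub_self]
    · rw [sub_lie, hy, hy, sub_self]
  · simp [eEnd_one]

lemma eEnd_eEnd (n p : ℤ) : ⁅eEnd K J n, eEnd K J p⁆ = 0 := by
  apply eq_zero_of_lie_mulX
  · rintro (q | k)
    · rw [lie_lie, eEnd_mulX_inl, eEnd_mulX_inl, lie_add, lie_add, lie_smul_one, lie_smul_one,
        ← lie_skew, hEnd_eEnd, ← lie_skew (eEnd K J p), hEnd_eEnd,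
        show p + q + n = n + q + p by ring]
      simp
    · rw [lie_lie, eEnd_mulX_inr, eEnd_mulX_inr, lie_smul_eq, lie_smul_eq, eEnd_pd_symm, sub_self]
  · simp [eEnd_one]

end BernardFelder

/-- the Bernard–Felder operators satisfy the `ŝl(2)` relations with
central charge `K`: `[h_n,h_p] = 2nKδ_{n+p,0}`, `[h_n,e_p] = 2e_{n+p}`,
`[h_n,f_p] = −2f_{n+p}`, `[e_n,f_p] = h_{n+p} + nKδ_{n+p,0}`, `[e_n,e_p] = [f_n,f_p] = 0`;
i.e. they define a representation of the affine Lie algebra `ŝl(2)` on `S` with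
`c ↦ K · id`. -/
theorem bernard_felder_relations (K J : ℂ) (n p : ℤ) :
    opComm (hop K J n) (hop K J p) =
      (2 * (n : ℂ) * K * (if n + p = 0 then 1 else 0)) • (id : SSpace → SSpace) ∧
    opComm (hop K J n) (eop K J p) = (2 : ℂ) • eop K J (n + p) ∧
    opComm (hop K J n) (fop p) = (-2 : ℂ) • fop (n + p) ∧
    opComm (eop K J n) (fop p) =
      hop K J (n + p) + ((n : ℂ) * K * (if n + p = 0 then 1 else 0)) • (id : SSpace → SSpace) ∧
    opComm (eop K J n) (eop K J p) = 0 ∧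
    opComm (fop n) (fop p) = 0 := by
  simp only [BernardFelder.hop_eq, BernardFelder.eop_eq, BernardFelder.fop_eq,
    BernardFelder.opComm_eq, BernardFelder.hEnd_hEnd, BernardFelder.hEnd_eEnd,
    BernardFelder.hEnd_mulX_inl, BernardFelder.eEnd_mulX_inl, BernardFelder.eEnd_eEnd,
    BernardFelder.mulX_mulX]
  exact ⟨rfl, rfl, rfl, rfl, rfl, rfl⟩
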